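/- Let i be a nonnegative integer and let α, β be complex numbers. Assume that (β)_{m+n} and (α/2)_n are nonzero for all nonnegative integers m, n, that no argument of Γ appearing on the right-hand side below is a nonpositive integer, and that the double series defining the Kampé de Fériet function converges absolutely. Then F^{1:1;2}_{1:0;1}[α : β−2−i ; 2+i, α/2+1 ; β : — ; α/2 ; −1, −1] = (2^{−2−α} · Γ(β/2)) / ((i+1)! · Γ(β/2−i−2)) · Σ_{r=0}^{i} (−1)^r · C(i,r) · Γ(β/4−1+(r−i)/2) / Γ(β/4+1+(r−i)/2). -/

import Mathlib

open Complex

noncomputable section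

/-- Pochhammer symbol `(a)_n = a (a+1) ⋯ (a+n-1)`. -/
def poch (a : ℂ) (n : ℕ) : ℂ := ∏ k ∈ Finset.range n, (a + k)

/-- `z` is not a nonpositive integer. -/
def notNonposInt (z : ℂ) : Prop := ∀ n : ℕ, z ≠ -(n : ℂ)

/-- Term of the Kampé de Fériet double series `F^{1:1;2}_{1:0;1}`. -/
def kdfTerm (α ε b₁ b₂ β d₁ x y : ℂ) (p : ℕ × ℕ) : ℂ :=
  poch α (p.1 + p.2) * poch ε p.1 * poch b₁ p.2 * poch b₂ p.2 /
    (poch β (p.1 + p.2) * poch d₁ p.2) * x ^ p.1 * y ^ p.2 /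
    ((p.1.factorial : ℂ) * (p.2.factorial : ℂ))

open Finset Filter Topology

lemma poch_zero (a : ℂ) : poch a 0 = 1 := by simp [poch]

lemma poch_succ (a : ℂ) (n : ℕ) : poch a (n + 1) = poch a n * (a + n) :=
  prod_range_succ _ _

lemma poch_succ_left (a : ℂ) (n : ℕ) : poch a (n + 1) = a * poch (a + 1) n := by
  simp only [poch, prod_range_succ']
  rw [mul_comm]
  congr 1
  · simp
  · exact prod_congr rfl fun k _ => by push_cast; ring

lemma Gamma_add_natCast {z : ℂ} (hz : notNonposInt z) (n : ℕ) :
    Gamma (z + n) = poch z n * Gamma z := by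
  induction n with
  | zero => simp [poch_zero]
  | succ n ih =>
    have h : z + n ≠ 0 := fun h => hz n (eq_neg_of_add_eq_zero_left h)
    rw [poch_succ, Nat.cast_succ, ← add_assoc, Gamma_add_one _ h, ih]
    ring

lemma succ_mul_choose_succ (r : ℂ) (n : ℕ) :
    ((n : ℂ) + 1) * Ring.choose r (n + 1) = r * Ring.choose (r - 1) n := by
  have h := Ring.choose_add_smul_choose (r - 1) n 1
  simpa using h

lemma poch_eq_choose (a : ℂ) (n : ℕ) :
    poch a n = (-1) ^ n * n.factorial * Ring.choose (-a) n := by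
  induction n generalizing a with
  | zero => simp [poch_zero]
  | succ n ih =>
    rw [poch_succ_left, ih, Nat.factorial_succ, neg_add']
    have h := succ_mul_choose_succ (-a) n
    push_cast
    linear_combination (-(-1) ^ (n + 1) * (n.factorial : ℂ)) * h

/-- The first moment of the Chu–Vandermonde convolution. -/
lemma add_mul_sum_choose_mul_choose_mul (r s : ℂ) (N : ℕ) :
    (r + s) * ∑ p ∈ antidiagonal N, Ring.choose r p.1 * Ring.choose s p.2 * p.2 =
      s * N * Ring.choose (r + s) N := by
  cases N with
  | zero => simp
  | succ N =>
    have h : ∑ p ∈ antidiagonal (N + 1), Ring.choose r p.1 * Ring.choose s p.2 * (p.2 : ℂ) =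
        s * Ring.choose (r + s - 1) N := by
      rw [Nat.sum_antidiagonal_succ', add_sub_assoc, Ring.add_choose_eq N (Commute.all _ _),
        mul_sum]
      simp only [Nat.cast_zero, mul_zero, zero_add]
      refine sum_congr rfl fun p _ => ?_
      have := succ_mul_choose_succ s p.2
      push_cast
      linear_combination Ring.choose r p.1 * this
    rw [h]
    have := succ_mul_choose_succ (r + s) N
    push_cast
    linear_combination -s * this

lemma hasSum_choose_mul_pow (a : ℂ) {z : ℂ} (hz : ‖z‖ < 1) :
    HasSum (fun n => Ring.choose a n * z ^ n) ((1 + z) ^ a) := by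
  have h := (one_add_cpow_hasFPowerSeriesOnBall_zero (a := a)).hasSum
    (y := z) (by simpa [← ofReal_norm] using hz)
  simpa only [binomialSeries_apply, List.ofFn_const, List.prod_replicate, smul_eq_mul,
    zero_add] using h

lemma hasSum_choose_mul_natCast_mul_pow (a : ℂ) {z : ℂ} (hz : ‖z‖ < 1) :
    HasSum (fun n => Ring.choose a n * n * z ^ n) (a * z * (1 + z) ^ (a - 1)) := by
  rw [← hasSum_nat_add_iff' 1]
  simp only [range_one, sum_singleton, Nat.cast_zero, mul_zero, zero_mul, sub_zero]
  convert! (hasSum_choose_mul_pow (a - 1) hz).mul_left (a * z) using 2 with n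
  have := succ_mul_choose_succ a n
  push_cast
  linear_combination z ^ (n + 1) * this

/-- Evaluation at the boundary point `1` of the convergence disc, by Abel's limit theorem. -/
lemma tsum_choose_mul_add_mul_natCast (a k : ℂ)
    (h : Summable fun n : ℕ => Ring.choose a n * (1 + k * n)) :
    ∑' n : ℕ, Ring.choose a n * (1 + k * n) = 2 ^ a + k * a * 2 ^ (a - 1) := by
  have habel := tendsto_tsum_powerSeries_nhdsWithin_lt h.hasSum.tendsto_sum_nat
  have hcont : ContinuousAt
      (fun z : ℂ => (1 + z) ^ a + k * (a * z * (1 + z) ^ (a - 1))) 1 := by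
    have h1 : (1 + 1 : ℂ) ∈ slitPlane := by norm_num
    have hz : ∀ b : ℂ, ContinuousAt (fun z : ℂ => (1 + z) ^ b) 1 := fun b =>
      (continuousAt_const.add continuousAt_id).cpow continuousAt_const h1
    exact (hz a).add (continuousAt_const.mul
      ((continuousAt_const.mul continuousAt_id).mul (hz (a - 1))))
  have hle : (𝓝[<] (1 : ℝ)).map ofReal ≤ 𝓝 (1 : ℂ) := by
    have := continuous_ofReal.tendsto (1 : ℝ)
    rw [ofReal_one] at this
    exact this.mono_left nhdsWithin_le_nhds
  have hlim := hcont.tendsto.mono_left hle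
  have hev : (fun z : ℂ => ∑' n : ℕ, Ring.choose a n * (1 + k * n) * z ^ n) =ᶠ[(𝓝[<] (1 : ℝ)).map
      ofReal] fun z : ℂ => (1 + z) ^ a + k * (a * z * (1 + z) ^ (a - 1)) := by
    rw [EventuallyEq, eventually_map]
    filter_upwards [Ioo_mem_nhdsLT (show (0 : ℝ) < 1 by norm_num)] with x hx
    have hx1 : ‖(x : ℂ)‖ < 1 := by
      rw [norm_real, Real.norm_of_nonneg hx.1.le]
      exact hx.2
    refine HasSum.tsum_eq ?_
    convert (hasSum_choose_mul_pow a hx1).add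
      ((hasSum_choose_mul_natCast_mul_pow a hx1).mul_left k) using 2
    ring
  have := tendsto_nhds_unique habel (hlim.congr' hev.symm)
  rw [this]
  norm_num
  ring

/-- The partial fraction expansion of `n! / (y)_{n+1}`. -/
lemma sum_neg_one_pow_mul_choose_div (n : ℕ) (y : ℂ) (hy : poch y (n + 1) ≠ 0) :
    ∑ r ∈ range (n + 1), (-1 : ℂ) ^ r * n.choose r / (y + r) = n.factorial / poch y (n + 1) := by
  induction n generalizing y with
  | zero => simp [poch_succ, poch_zero]
  | succ n ih =>
    have hr := poch_succ y (n + 1)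
    have hl := poch_succ_left y (n + 1)
    have hy1 : poch y (n + 1) ≠ 0 := left_ne_zero_of_mul (hr ▸ hy)
    have hy4 : poch (y + 1) (n + 1) ≠ 0 := right_ne_zero_of_mul (hl ▸ hy)
    have hp := sum_choose_succ_mul (fun r _ => (-1 : ℂ) ^ r / (y + r)) n
    have h1 := ih y hy1
    have h2 := ih (y + 1) hy4
    have e0 : ∑ r ∈ range (n + 1 + 1), (-1 : ℂ) ^ r * (n + 1).choose r / (y + r) =
        ∑ r ∈ range (n + 1), (-1 : ℂ) ^ r * n.choose r / (y + r) -
        ∑ r ∈ range (n + 1), (-1 : ℂ) ^ r * n.choose r / (y + 1 + r) := by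
      calc _ = _ := sum_congr rfl fun r _ => by ring
        _ = _ := hp
        _ = _ := by
          rw [sub_eq_add_neg, ← sum_neg_distrib]
          congr 1
          · exact sum_congr rfl fun r _ => by ring
          · exact sum_congr rfl fun r _ => by push_cast; ring
    rw [e0, h1, h2, div_sub_div _ _ hy1 hy4, div_eq_div_iff (mul_ne_zero hy1 hy4) hy,
      Nat.factorial_succ]
    rw [hr] at hl ⊢
    push_cast at hl ⊢
    linear_combination (-(n.factorial : ℂ) * poch y (n + 1)) * hl

lemma sum_choose_mul_Gamma_div_Gamma (i : ℕ) (y : ℂ)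
    (h : ∀ r : ℕ, r ≤ i → notNonposInt ((y + r) / 2)) :
    ∑ r ∈ range (i + 1), (-1 : ℂ) ^ r * (i.choose r : ℂ) * Gamma ((y + r) / 2) /
        Gamma ((y + r) / 2 + 2) =
      2 * i.factorial * (1 / poch y (i + 1) - 1 / poch (y + 2) (i + 1)) := by
  have hw : ∀ r : ℕ, r ≤ i → y + r ≠ 0 ∧ y + 2 + r ≠ 0 := fun r hr =>
    ⟨fun h0 => h r hr 0 (by simp [h0]), fun h0 => h r hr 1 (by
      push_cast
      linear_combination h0 / 2)⟩
  have hy1 : poch y (i + 1) ≠ 0 :=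
    prod_ne_zero_iff.2 fun r hr => (hw r (Nat.lt_succ_iff.1 (mem_range.1 hr))).1
  have hy2 : poch (y + 2) (i + 1) ≠ 0 :=
    prod_ne_zero_iff.2 fun r hr => (hw r (Nat.lt_succ_iff.1 (mem_range.1 hr))).2
  have key : (2 : ℂ) * i.factorial * (1 / poch y (i + 1) - 1 / poch (y + 2) (i + 1)) =
      2 * (i.factorial / poch y (i + 1)) - 2 * (i.factorial / poch (y + 2) (i + 1)) := by ring
  rw [key, ← sum_neg_one_pow_mul_choose_div i y hy1,
    ← sum_neg_one_pow_mul_choose_div i (y + 2) hy2, mul_sum, mul_sum, ← sum_sub_distrib]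
  refine sum_congr rfl fun r hr => ?_
  have hri := Nat.lt_succ_iff.1 (mem_range.1 hr)
  obtain ⟨h1, h2⟩ := hw r hri
  have hG := Gamma_add_natCast (h r hri) 2
  have hG0 : Gamma ((y + r) / 2) ≠ 0 := Gamma_ne_zero (h r hri)
  have hp : poch ((y + r) / 2) 2 = (y + r) * (y + 2 + r) / 4 := by
    simp [poch_succ, poch_zero]
    ring
  rw [hp, Nat.cast_ofNat] at hG
  rw [hG]
  field_simp
  ring

lemma Gamma_div_mul_sum_choose_mul_Gamma_div_Gamma (i : ℕ) (b : ℂ) (hb : b ≠ 0)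
    (hb2 : notNonposInt (b - i - 2))
    (h : ∀ r : ℕ, r ≤ i → notNonposInt ((b - i - 2 + r) / 2)) :
    Gamma b / (((i + 1).factorial : ℂ) * Gamma (b - i - 2)) *
      ∑ r ∈ range (i + 1), (-1 : ℂ) ^ r * (i.choose r : ℂ) * Gamma ((b - i - 2 + r) / 2) /
        Gamma ((b - i - 2 + r) / 2 + 2) = 2 * (2 * b - i - 2) / b := by
  rw [sum_choose_mul_Gamma_div_Gamma i _ h]
  set y := b - i - 2 with hy
  have hyb : y + (i + 2 : ℕ) = b := by push_cast; rw [hy]; ring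
  have hG := Gamma_add_natCast hb2 (i + 2)
  rw [hyb] at hG
  have hG0 : Gamma y ≠ 0 := Gamma_ne_zero hb2
  have hne : ∀ n, poch y n ≠ 0 := fun n =>
    prod_ne_zero_iff.2 fun k _ h0 => hb2 k (eq_neg_of_add_eq_zero_left h0)
  have h3 : poch y (i + 3) = y * ((y + 1) * poch (y + 2) (i + 1)) := by
    rw [poch_succ_left, poch_succ_left, add_assoc, one_add_one_eq_two]
  have h3' : poch y (i + 3) = poch y (i + 1) * (y + (i + 1 : ℕ)) * b := by
    rw [poch_succ, poch_succ, hyb]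
  have h2 : poch y (i + 2) = poch y (i + 1) * (y + (i + 1 : ℕ)) := poch_succ _ _
  have hP := hne (i + 1)
  have hQ : poch (y + 2) (i + 1) ≠ 0 := by
    have := hne (i + 3)
    rw [h3] at this
    exact right_ne_zero_of_mul (right_ne_zero_of_mul this)
  have hi : (i : ℂ) + 1 ≠ 0 := by exact_mod_cast i.succ_ne_zero
  have hf : (i.factorial : ℂ) ≠ 0 := by exact_mod_cast i.factorial_ne_zero
  have e1 : poch y (i + 2) / poch y (i + 1) = b - 1 := by
    rw [h2, mul_div_cancel_left₀ _ hP]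
    push_cast
    rw [hy]
    ring
  have e2 : poch y (i + 2) / poch (y + 2) (i + 1) = y * (y + 1) / b := by
    rw [div_eq_div_iff hQ hb, h2, ← h3', h3]
    ring
  calc _ = 2 / ((i : ℂ) + 1) * (poch y (i + 2) / poch y (i + 1) -
        poch y (i + 2) / poch (y + 2) (i + 1)) := by
        rw [hG, Nat.factorial_succ]
        push_cast
        field_simp
    _ = _ := by
        rw [e1, e2, hy]
        field_simp
        ring

lemma kdfTerm_eq_choose {α ε b β : ℂ} (hα : α ≠ 0) (hd : ∀ n, poch (α / 2) n ≠ 0) (p : ℕ × ℕ) :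
    kdfTerm α ε b (α / 2 + 1) β (α / 2) (-1) (-1) p =
      poch α (p.1 + p.2) / poch β (p.1 + p.2) *
        (Ring.choose (-ε) p.1 * Ring.choose (-b) p.2 +
          2 / α * (Ring.choose (-ε) p.1 * Ring.choose (-b) p.2 * p.2)) := by
  obtain ⟨m, n⟩ := p
  have hq : poch (α / 2 + 1) n / poch (α / 2) n = 1 + 2 / α * n := by
    have h1 := poch_succ (α / 2) n
    rw [poch_succ_left] at h1
    rw [div_eq_iff (hd n)]
    generalize poch (α / 2 + 1) n = A, poch (α / 2) n = B at h1
    field_simp at h1 ⊢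
    linear_combination h1
  have hs : ∀ k : ℕ, ((-1 : ℂ) ^ k) * (-1) ^ k = 1 := fun k => by
    rw [← mul_pow]; norm_num
  calc kdfTerm α ε b (α / 2 + 1) β (α / 2) (-1) (-1) (m, n)
      = poch α (m + n) / poch β (m + n) * (poch (α / 2 + 1) n / poch (α / 2) n) *
          ((poch ε m * (-1) ^ m / m.factorial) * (poch b n * (-1) ^ n / n.factorial)) := by
        simp only [kdfTerm, div_eq_mul_inv, mul_inv]
        ring
    _ = _ := by
        have hc : ∀ (a : ℂ) (k : ℕ), poch a k * (-1) ^ k / k.factorial = Ring.choose (-a) k := by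
          intro a k
          rw [poch_eq_choose, div_eq_iff (by exact_mod_cast k.factorial_ne_zero)]
          linear_combination (k.factorial : ℂ) * Ring.choose (-a) k * hs k
        rw [hq, hc, hc]
        ring

lemma sum_antidiagonal_kdfTerm {α ε b : ℂ} (hα : α ≠ 0) (hd : ∀ n, poch (α / 2) n ≠ 0)
    (hβ : ∀ n, poch (ε + b) n ≠ 0) (N : ℕ) :
    ∑ p ∈ antidiagonal N, kdfTerm α ε b (α / 2 + 1) (ε + b) (α / 2) (-1) (-1) p =
      Ring.choose (-α) N * (1 + 2 * b / (α * (ε + b)) * N) := by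
  have hβ0 : ε + b ≠ 0 := by simpa [poch_succ, poch_zero] using hβ 1
  have h0 := Ring.add_choose_eq N (Commute.all (-ε) (-b))
  have h1 := add_mul_sum_choose_mul_choose_mul (-ε) (-b) N
  have hsum : ∑ p ∈ antidiagonal N, kdfTerm α ε b (α / 2 + 1) (ε + b) (α / 2) (-1) (-1) p =
      poch α N / poch (ε + b) N *
        (∑ p ∈ antidiagonal N, Ring.choose (-ε) p.1 * Ring.choose (-b) p.2 + 2 / α *
          ∑ p ∈ antidiagonal N, Ring.choose (-ε) p.1 * Ring.choose (-b) p.2 * p.2) := by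
    rw [mul_sum, ← sum_add_distrib, mul_sum]
    refine sum_congr rfl fun p hp => ?_
    rw [kdfTerm_eq_choose hα hd, mem_antidiagonal.1 hp]
  have h1' : ∑ p ∈ antidiagonal N, Ring.choose (-ε) p.1 * Ring.choose (-b) p.2 * (p.2 : ℂ) =
      b / (ε + b) * N * Ring.choose (-ε + -b) N := by
    field_simp
    linear_combination -h1
  have hbN := hβ N
  rw [hsum, h1', ← h0, div_mul_eq_mul_div, div_eq_iff hbN, poch_eq_choose α, poch_eq_choose (ε + b),
    neg_add]
  field_simp

theorem stmt_4 (i : ℕ) (α β : ℂ)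
    (hβ : ∀ m n : ℕ, poch β (m + n) ≠ 0)
    (hd : ∀ n : ℕ, poch (α / 2) n ≠ 0)
    (hΓ1 : notNonposInt (β / 2))
    (hΓ2 : notNonposInt (β / 2 - (i : ℂ) - 2))
    (hΓs : ∀ r : ℕ, r ≤ i →
      notNonposInt (β / 4 - 1 + ((r : ℂ) - (i : ℂ)) / 2) ∧ notNonposInt (β / 4 + 1 + ((r : ℂ) - (i : ℂ)) / 2))
    (hsum : Summable fun p : ℕ × ℕ => ‖kdfTerm α (β - 2 - (i : ℂ)) (2 + (i : ℂ)) (α / 2 + 1) β (α / 2) (-1) (-1) p‖) :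
    (∑' p : ℕ × ℕ, kdfTerm α (β - 2 - (i : ℂ)) (2 + (i : ℂ)) (α / 2 + 1) β (α / 2) (-1) (-1) p) =
      (2 : ℂ) ^ (-2 - α) * Gamma (β / 2) /
        (((i + 1).factorial : ℂ) * Gamma (β / 2 - (i : ℂ) - 2)) *
      ∑ r ∈ Finset.range (i + 1), (-1 : ℂ) ^ r * (i.choose r : ℂ) *
        Gamma (β / 4 - 1 + ((r : ℂ) - (i : ℂ)) / 2) /
        Gamma (β / 4 + 1 + ((r : ℂ) - (i : ℂ)) / 2) := by
  have hα0 : α ≠ 0 := by simpa [poch_succ, poch_zero] using hd 1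
  have hβ0 : β ≠ 0 := by simpa [poch_succ, poch_zero] using hβ 0 1
  have hεb : β - 2 - (i : ℂ) + (2 + i) = β := by ring
  have hanti := sum_antidiagonal_kdfTerm (ε := β - 2 - (i : ℂ)) (b := 2 + (i : ℂ)) hα0 hd
    (fun n => by rw [hεb]; simpa using hβ 0 n)
  rw [hεb] at hanti
  have hs := hsum.of_norm
  have hσ : HasSum (fun N : ℕ => Ring.choose (-α) N * (1 + 2 * (2 + i) / (α * β) * N))
      (∑' p, kdfTerm α (β - 2 - (i : ℂ)) (2 + (i : ℂ)) (α / 2 + 1) β (α / 2) (-1) (-1) p) := by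
    have := (HasAntidiagonal.sigmaAntidiagonalEquivProd.hasSum_iff.2 hs.hasSum).sigma
      (fun N => hasSum_fintype _)
    convert! this using 2 with N
    rw [← hanti N]
    exact (sum_coe_sort (antidiagonal N)
      (kdfTerm α (β - 2 - (i : ℂ)) (2 + (i : ℂ)) (α / 2 + 1) β (α / 2) (-1) (-1))).symm
  have hw1 : ∀ r : ℕ, β / 4 - 1 + ((r : ℂ) - i) / 2 = (β / 2 - i - 2 + r) / 2 := fun r => by ring
  have hw2 : ∀ r : ℕ, β / 4 + 1 + ((r : ℂ) - i) / 2 = (β / 2 - i - 2 + r) / 2 + 2 := fun r => by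
    ring
  have hR := Gamma_div_mul_sum_choose_mul_Gamma_div_Gamma i (β / 2) (by simpa using hβ0) hΓ2
    (fun r hr => hw1 r ▸ (hΓs r hr).1)
  simp only [hw1, hw2]
  rw [mul_div_assoc, mul_assoc, hR, ← hσ.tsum_eq, tsum_choose_mul_add_mul_natCast _ _ hσ.summable,
    cpow_sub _ _ two_ne_zero, show -2 - α = -α - 2 by ring, cpow_sub _ _ two_ne_zero]
  norm_num
  field_simp
  ring
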